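/- arXiv:1702.03569 — 3 statements merged into one kernel-verified Lean document; each statement's English description precedes it below -/
import Mathlib

section
/- In the braid group Br_n, the Jucys–Murphy elements pairwise commute: δ_i · δ_j = δ_j · δ_i for all 1 ≤ i, j ≤ n−1. -/
/-- The defining relators of the braid group `Br_n` on `n` strands, with generators
`σ_1, …, σ_{n-1}` indexed (0-based) by `Fin (n-1)`:
`σ_i σ_{i+1} σ_i = σ_{i+1} σ_i σ_{i+1}` and `σ_i σ_j = σ_j σ_i` for `|i - j| > 1`. -/
def BraidRels (n : ℕ) : Set (FreeGroup (Fin (n - 1))) :=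
  { r | (∃ i j : Fin (n - 1), (i : ℕ) + 1 = (j : ℕ) ∧
          r = FreeGroup.of i * FreeGroup.of j * FreeGroup.of i *
              (FreeGroup.of j * FreeGroup.of i * FreeGroup.of j)⁻¹) ∨
        (∃ i j : Fin (n - 1), (i : ℕ) + 1 < (j : ℕ) ∧
          r = FreeGroup.of i * FreeGroup.of j *
              (FreeGroup.of j * FreeGroup.of i)⁻¹) }

/-- The braid group `Br_n` as a presented group. -/
abbrev BraidGroup (n : ℕ) := PresentedGroup (BraidRels n)

/-- The standard generator `σ_{i+1}` (1-based) of the braid group. -/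
def σB {n : ℕ} (i : Fin (n - 1)) : BraidGroup n := PresentedGroup.of i

/-- The ascending list of generators `[σ_i, σ_{i+1}, …, σ_{n-1}]` (0-based indices `i … n-2`). -/
def ascListB (n : ℕ) (i : Fin (n - 1)) : List (BraidGroup n) :=
  ((List.finRange (n - 1)).filter (fun k => decide (i ≤ k))).map σB

/-- The Jucys–Murphy element
`δ_i = σ_i σ_{i+1} ⋯ σ_{n-2} σ_{n-1} σ_{n-1} σ_{n-2} ⋯ σ_{i+1} σ_i`. -/
def JM {n : ℕ} (i : Fin (n - 1)) : BraidGroup n :=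
  (ascListB n i).prod * (ascListB n i).reverse.prod

section AbstractBraid

variable {G : Type*} [Group G] {s D : ℕ → G} {N : ℕ}

/-- Elements `D m` built from `s m, s (m + 1), …` commute with generators far to the left. -/
theorem commute_palindrome_of_add_one_lt
    (hD : ∀ i, D i = s i * D (i + 1) * s i) (hN : ∀ i, N ≤ i → D i = 1)
    (hs : ∀ i j, i + 1 < j → Commute (s i) (s j)) {k m : ℕ} (hkm : k + 1 < m) :
    Commute (s k) (D m) := by
  obtain ⟨e, he⟩ : ∃ e, N ≤ m + e := ⟨N, by omega⟩
  induction e generalizing m with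
  | zero => rw [hN m (by omega)]; exact Commute.one_right _
  | succ e ih =>
    rw [hD m]
    have h := hs k m hkm
    exact (h.mul_right (ih (by omega) (by omega))).mul_right h

/-- The palindrome `a b x b a` commutes with `b` when `a`, `b` satisfy the braid relation and
`a` commutes with `x`. -/
theorem commute_palindrome_of_braid {a b x : G} (hab : a * b * a = b * a * b)
    (hax : Commute a x) : Commute b (a * (b * x * b) * a) := by
  calc b * (a * (b * x * b) * a) = (b * a * b) * x * b * a := by group
    _ = a * b * (a * x) * b * a := by rw [← hab]; group
    _ = a * b * x * (a * b * a) := by rw [hax.eq]; group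
    _ = a * (b * x * b) * a * b := by rw [hab]; group

/-- The palindrome `D m` commutes with every generator of index greater than `m`. -/
theorem commute_palindrome_of_lt
    (hD : ∀ i, D i = s i * D (i + 1) * s i) (hN : ∀ i, N ≤ i → D i = 1)
    (hs : ∀ i j, i + 1 < j → Commute (s i) (s j))
    (hb : ∀ i, i + 1 < N → s i * s (i + 1) * s i = s (i + 1) * s i * s (i + 1))
    {k m : ℕ} (hmk : m < k) (hk : k < N) : Commute (s k) (D m) := by
  obtain ⟨e, rfl⟩ := Nat.exists_eq_add_of_lt hmk
  induction e generalizing m with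
  | zero =>
    rw [hD m, hD (m + 1)]
    exact commute_palindrome_of_braid (hb m (by omega))
      (commute_palindrome_of_add_one_lt hD hN hs (by omega))
  | succ e ih =>
    rw [hD m]
    have h := (hs m (m + (e + 1) + 1) (by omega)).symm
    have h' := ih (m := m + 1) (by omega) (by omega)
    rw [show m + 1 + e + 1 = m + (e + 1) + 1 by omega] at h'
    exact (h.mul_right h').mul_right h

/-- The palindromes in braid generators pairwise commute. -/
theorem commute_palindrome_palindrome
    (hD : ∀ i, D i = s i * D (i + 1) * s i) (hN : ∀ i, N ≤ i → D i = 1)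
    (hs : ∀ i j, i + 1 < j → Commute (s i) (s j))
    (hb : ∀ i, i + 1 < N → s i * s (i + 1) * s i = s (i + 1) * s i * s (i + 1))
    {i j : ℕ} (hij : i < j) : Commute (D i) (D j) := by
  obtain ⟨e, he⟩ : ∃ e, N ≤ j + e := ⟨N, by omega⟩
  induction e generalizing j with
  | zero => rw [hN j (by omega)]; exact Commute.one_right _
  | succ e ih =>
    rcases le_or_gt N j with hj | hj
    · rw [hN j hj]; exact Commute.one_right _
    · rw [hD j]
      have h := (commute_palindrome_of_lt hD hN hs hb hij hj).symm
      exact (h.mul_right (ih (by omega) (by omega))).mul_right h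

end AbstractBraid

theorem filter_le_finRange (N p : ℕ) (hp : p < N) :
    (List.finRange N).filter (fun k : Fin N => decide (p ≤ (k : ℕ))) =
      ⟨p, hp⟩ :: (List.finRange N).filter (fun k : Fin N => decide (p + 1 ≤ (k : ℕ))) := by
  induction N generalizing p with
  | zero => omega
  | succ N ih =>
    cases p with
    | zero => simp [List.finRange_succ, List.filter_map, Function.comp_def]
    | succ p =>
      simp [List.finRange_succ, List.filter_map, Function.comp_def, ih p (by omega)]

theorem σB_braid {n : ℕ} {i j : Fin (n - 1)} (h : (i : ℕ) + 1 = j) :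
    σB i * σB j * σB i = σB j * σB i * σB j :=
  PresentedGroup.mk_eq_mk_of_mul_inv_mem (rels := BraidRels n) (Or.inl ⟨i, j, h, rfl⟩)

theorem σB_commute {n : ℕ} {i j : Fin (n - 1)} (h : (i : ℕ) + 1 < j) :
    Commute (σB i) (σB j) :=
  PresentedGroup.mk_eq_mk_of_mul_inv_mem (rels := BraidRels n) (Or.inr ⟨i, j, h, rfl⟩)

/-- The braid generators indexed by all naturals, extended by `1`. -/
def natσB (n k : ℕ) : BraidGroup n := if h : k < n - 1 then σB ⟨k, h⟩ else 1

/-- The list of braid generators of index at least `p`. -/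
def natAscListB (n p : ℕ) : List (BraidGroup n) :=
  ((List.finRange (n - 1)).filter (fun k : Fin (n - 1) => decide (p ≤ (k : ℕ)))).map σB

/-- The Jucys–Murphy elements indexed by all naturals, extended by `1`. -/
def natJM (n p : ℕ) : BraidGroup n := (natAscListB n p).prod * (natAscListB n p).reverse.prod

theorem natJM_of_le {n p : ℕ} (h : n - 1 ≤ p) : natJM n p = 1 := by
  have : natAscListB n p = [] := by
    simp only [natAscListB, List.map_eq_nil_iff, List.filter_eq_nil_iff, decide_eq_true_eq]
    intro a _
    omega
  simp [natJM, this]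

theorem natJM_eq (n p : ℕ) : natJM n p = natσB n p * natJM n (p + 1) * natσB n p := by
  by_cases h : p < n - 1
  · have : natAscListB n p = natσB n p :: natAscListB n (p + 1) := by
      simp [natAscListB, natσB, h, filter_le_finRange _ p h]
    simp [natJM, this, mul_assoc]
  · simp [natJM_of_le (n := n) (p := p) (by omega), natJM_of_le (n := n) (p := p + 1) (by omega),
      natσB, h]

theorem natσB_commute (n i j : ℕ) (h : i + 1 < j) : Commute (natσB n i) (natσB n j) := by
  unfold natσB
  split_ifs
  · exact σB_commute h
  all_goals simp

theorem natσB_braid (n i : ℕ) (h : i + 1 < n - 1) :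
    natσB n i * natσB n (i + 1) * natσB n i =
      natσB n (i + 1) * natσB n i * natσB n (i + 1) := by
  have h' : i < n - 1 := by omega
  simp only [natσB, h, h', dif_pos]
  exact σB_braid rfl

/-- The Jucys–Murphy elements of the braid group pairwise commute. -/
theorem jucysMurphy_commute (n : ℕ) (hn : 2 ≤ n) (i j : Fin (n - 1)) :
    JM i * JM j = JM j * JM i := by
  change Commute (natJM n i) (natJM n j)
  have key {a b : ℕ} (h : a < b) : Commute (natJM n a) (natJM n b) :=
    commute_palindrome_palindrome (natJM_eq n) (fun _ => natJM_of_le) (natσB_commute n)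
      (natσB_braid n) h
  rcases lt_trichotomy (i : ℕ) j with h | h | h
  · exact key h
  · rw [h]
  · exact (key h).symm
end

section
/- In the affine braid group Br_n^aff, the Bernstein–Lusztig elements Δ_1, …, Δ_{n−1} together with the generator Δ_n pairwise commute: Δ_i · Δ_j = Δ_j · Δ_i for all 1 ≤ i, j ≤ n. -/
/-- Generators of the affine braid group `Br_n^aff`: `Sum.inl i` is the finite generator
`σ_{i+1}` (1-based) and `Sum.inr ()` is the flag-pole generator `Δ_n`. -/
abbrev AffGen (n : ℕ) := Fin (n - 1) ⊕ Unit

/-- The defining relators of the affine braid group `Br_n^aff`: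
braid relations among the `σ_i`; `σ_{n-1} Δ_n σ_{n-1} Δ_n = Δ_n σ_{n-1} Δ_n σ_{n-1}`;
and `σ_i Δ_n = Δ_n σ_i` for `i < n - 1`. -/
def AffBraidRels (n : ℕ) : Set (FreeGroup (AffGen n)) :=
  { r | (∃ i j : Fin (n - 1), (i : ℕ) + 1 = (j : ℕ) ∧
          r = FreeGroup.of (.inl i) * FreeGroup.of (.inl j) * FreeGroup.of (.inl i) *
              (FreeGroup.of (.inl j) * FreeGroup.of (.inl i) * FreeGroup.of (.inl j))⁻¹) ∨
        (∃ i j : Fin (n - 1), (i : ℕ) + 1 < (j : ℕ) ∧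
          r = FreeGroup.of (.inl i) * FreeGroup.of (.inl j) *
              (FreeGroup.of (.inl j) * FreeGroup.of (.inl i))⁻¹) ∨
        (∃ i : Fin (n - 1), (i : ℕ) + 1 = n - 1 ∧
          r = FreeGroup.of (.inl i) * FreeGroup.of (.inr ()) * FreeGroup.of (.inl i) *
                FreeGroup.of (.inr ()) *
              (FreeGroup.of (.inr ()) * FreeGroup.of (.inl i) * FreeGroup.of (.inr ()) *
                FreeGroup.of (.inl i))⁻¹) ∨
        (∃ i : Fin (n - 1), (i : ℕ) + 1 < n - 1 ∧
          r = FreeGroup.of (.inl i) * FreeGroup.of (.inr ()) *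
              (FreeGroup.of (.inr ()) * FreeGroup.of (.inl i))⁻¹) }

/-- The affine braid group `Br_n^aff` as a presented group. -/
abbrev AffBraidGroup (n : ℕ) := PresentedGroup (AffBraidRels n)

/-- The finite generator `σ_{i+1}` (1-based) of the affine braid group. -/
def σA {n : ℕ} (i : Fin (n - 1)) : AffBraidGroup n := PresentedGroup.of (.inl i)

/-- The flag-pole generator `Δ_n` of the affine braid group. -/
def ΔA (n : ℕ) : AffBraidGroup n := PresentedGroup.of (.inr ())

/-- The ascending list of generators `[σ_i, σ_{i+1}, …, σ_{n-1}]` (0-based indices `i … n-2`). -/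
def ascListA (n : ℕ) (i : Fin (n - 1)) : List (AffBraidGroup n) :=
  ((List.finRange (n - 1)).filter (fun k => decide (i ≤ k))).map σA

/-- The Bernstein–Lusztig element
`Δ_i = σ_i σ_{i+1} ⋯ σ_{n-1} Δ_n σ_{n-1} ⋯ σ_{i+1} σ_i` for `i = 1, …, n-1` (1-based). -/
def BL {n : ℕ} (i : Fin (n - 1)) : AffBraidGroup n :=
  (ascListA n i).prod * ΔA n * (ascListA n i).reverse.prod

/-- The full family `Δ_1, …, Δ_{n-1}, Δ_n`: the Bernstein–Lusztig elements together with the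
generator `Δ_n`. -/
def BLfull {n : ℕ} : AffGen n → AffBraidGroup n
  | .inl i => BL i
  | .inr _ => ΔA n

/-- The elements `T 0 = D`, `T (k + 1) = s k * T k * s k` built from a sequence `s` in a monoid. -/
def sandwich {G : Type*} [Monoid G] (s : ℕ → G) (D : G) : ℕ → G
  | 0 => D
  | k + 1 => s k * sandwich s D k * s k

section Sandwich

variable {G : Type*} [Monoid G] {s : ℕ → G} {D : G} {m : ℕ}

theorem commute_sandwich_of_lt
    (hfar : ∀ i j, i + 1 < j → j < m → Commute (s i) (s j))
    (hD : ∀ j, 0 < j → j < m → Commute (s j) D) {j k : ℕ} (hkj : k < j) (hj : j < m) :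
    Commute (s j) (sandwich s D k) := by
  induction k with
  | zero => exact hD j hkj hj
  | succ k ih =>
    have h := (hfar k j hkj hj).symm
    exact (h.mul_right (ih (by omega))).mul_right h

theorem commute_sandwich_of_add_two_le
    (hbraid : ∀ i, i + 1 < m → s i * s (i + 1) * s i = s (i + 1) * s i * s (i + 1))
    (hfar : ∀ i j, i + 1 < j → j < m → Commute (s i) (s j))
    (hD : ∀ j, 0 < j → j < m → Commute (s j) D) {j k : ℕ} (hjk : j + 2 ≤ k) (hk : k ≤ m) :
    Commute (s j) (sandwich s D k) := by
  induction k, hjk using Nat.le_induction with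
  | base =>
    have hb := hbraid j (by omega)
    have hc : s (j + 1) * sandwich s D j = sandwich s D j * s (j + 1) :=
      commute_sandwich_of_lt hfar hD (Nat.lt_succ_self j) (by omega)
    change s j * (s (j + 1) * (s j * sandwich s D j * s j) * s (j + 1)) =
      s (j + 1) * (s j * sandwich s D j * s j) * s (j + 1) * s j
    generalize sandwich s D j = T at hc
    generalize s j = a at hb
    generalize s (j + 1) = b at hb hc
    calc a * (b * (a * T * a) * b) = (a * b * a) * T * a * b := by simp only [mul_assoc]
      _ = b * a * (b * T) * a * b := by rw [hb]; simp only [mul_assoc]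
      _ = b * a * T * (b * a * b) := by rw [hc]; simp only [mul_assoc]
      _ = b * (a * T * a) * b * a := by rw [← hb]; simp only [mul_assoc]
  | succ k hjk ih =>
    have h := hfar j k (by omega) (by omega)
    exact (h.mul_right (ih (by omega))).mul_right h

theorem commute_sandwich_sandwich_of_succ
    (hfar : ∀ i j, i + 1 < j → j < m → Commute (s i) (s j))
    (hD : ∀ j, 0 < j → j < m → Commute (s j) D) {k l : ℕ}
    (h : Commute (sandwich s D k) (sandwich s D (k + 1))) (hkl : k + 1 ≤ l) (hl : l ≤ m) :
    Commute (sandwich s D k) (sandwich s D l) := by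
  induction l, hkl using Nat.le_induction with
  | base => exact h
  | succ l hkl ih =>
    have h' := (commute_sandwich_of_lt hfar hD (k := k) (j := l) (by omega) (by omega)).symm
    exact (h'.mul_right (ih (by omega))).mul_right h'

theorem commute_sandwich_succ
    (hbraid : ∀ i, i + 1 < m → s i * s (i + 1) * s i = s (i + 1) * s i * s (i + 1))
    (hfar : ∀ i j, i + 1 < j → j < m → Commute (s i) (s j))
    (hD : ∀ j, 0 < j → j < m → Commute (s j) D)
    (hlast : 0 < m → s 0 * D * s 0 * D = D * s 0 * D * s 0) {k : ℕ} (hk : k + 1 ≤ m) :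
    Commute (sandwich s D k) (sandwich s D (k + 1)) := by
  induction k with
  | zero =>
    change D * (s 0 * D * s 0) = s 0 * D * s 0 * D
    rw [hlast (by omega)]
    simp only [mul_assoc]
  | succ k ih =>
    have h₁ : Commute (s k) (sandwich s D (k + 1 + 1)) :=
      commute_sandwich_of_add_two_le hbraid hfar hD le_rfl hk
    have h₂ : Commute (sandwich s D k) (sandwich s D (k + 1 + 1)) :=
      commute_sandwich_sandwich_of_succ hfar hD (ih (by omega)) (by omega) hk
    exact (h₁.mul_left h₂).mul_left h₁

theorem commute_sandwich_sandwich
    (hbraid : ∀ i, i + 1 < m → s i * s (i + 1) * s i = s (i + 1) * s i * s (i + 1))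
    (hfar : ∀ i j, i + 1 < j → j < m → Commute (s i) (s j))
    (hD : ∀ j, 0 < j → j < m → Commute (s j) D)
    (hlast : 0 < m → s 0 * D * s 0 * D = D * s 0 * D * s 0) {k l : ℕ} (hk : k ≤ m) (hl : l ≤ m) :
    Commute (sandwich s D k) (sandwich s D l) := by
  have key : ∀ {k l : ℕ}, k < l → l ≤ m → Commute (sandwich s D k) (sandwich s D l) :=
    fun hkl hl => commute_sandwich_sandwich_of_succ hfar hD
      (commute_sandwich_succ hbraid hfar hD hlast (by omega)) hkl hl
  rcases lt_trichotomy k l with h | rfl | h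
  · exact key h hl
  · exact Commute.refl _
  · exact (key h hk).symm

end Sandwich

theorem List.filter_le_finRange_eq_cons {m p : ℕ} (hp : p < m) :
    (List.finRange m).filter (fun k : Fin m => decide (p ≤ (k : ℕ))) =
      ⟨p, hp⟩ :: (List.finRange m).filter (fun k : Fin m => decide (p + 1 ≤ (k : ℕ))) := by
  induction m generalizing p with
  | zero => omega
  | succ m ih =>
    rw [List.finRange_succ]
    cases p with
    | zero => simp [List.filter_map, Function.comp_def]
    | succ p =>
      have h := congrArg (List.map Fin.succ) (ih (p := p) (by omega))
      simpa [List.filter_map, Function.comp_def] using h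

section Relations

variable {n : ℕ}

theorem σA_braid (i j : Fin (n - 1)) (h : (i : ℕ) + 1 = j) :
    σA i * σA j * σA i = σA j * σA i * σA j :=
  PresentedGroup.mk_eq_mk_of_mul_inv_mem (rels := AffBraidRels n) (Or.inl ⟨i, j, h, rfl⟩)

theorem σA_commute (i j : Fin (n - 1)) (h : (i : ℕ) + 1 < j) : Commute (σA i) (σA j) :=
  PresentedGroup.mk_eq_mk_of_mul_inv_mem (rels := AffBraidRels n)
    (Or.inr (Or.inl ⟨i, j, h, rfl⟩))

theorem σA_mul_ΔA_braid (i : Fin (n - 1)) (h : (i : ℕ) + 1 = n - 1) :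
    σA i * ΔA n * σA i * ΔA n = ΔA n * σA i * ΔA n * σA i :=
  PresentedGroup.mk_eq_mk_of_mul_inv_mem (rels := AffBraidRels n)
    (Or.inr (Or.inr (Or.inl ⟨i, h, rfl⟩)))

theorem σA_commute_ΔA (i : Fin (n - 1)) (h : (i : ℕ) + 1 < n - 1) : Commute (σA i) (ΔA n) :=
  PresentedGroup.mk_eq_mk_of_mul_inv_mem (rels := AffBraidRels n)
    (Or.inr (Or.inr (Or.inr ⟨i, h, rfl⟩)))

end Relations

/-- The finite generators in reverse order, `σ_{n-1}, σ_{n-2}, …, σ_1`, extended by `1`. -/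
def revσA (n k : ℕ) : AffBraidGroup n :=
  if h : k < n - 1 then σA ⟨n - 1 - 1 - k, by omega⟩ else 1

theorem revσA_of_lt {n k : ℕ} (h : k < n - 1) :
    revσA n k = σA ⟨n - 1 - 1 - k, by omega⟩ := dif_pos h

theorem sandwich_revσA_eq {n k : ℕ} (hk : k ≤ n - 1) :
    sandwich (revσA n) (ΔA n) k =
      (((List.finRange (n - 1)).filter (fun i : Fin (n - 1) => decide (n - 1 - k ≤ (i : ℕ)))).map σA).prod *
        ΔA n *
      (((List.finRange (n - 1)).filter
        (fun i : Fin (n - 1) => decide (n - 1 - k ≤ (i : ℕ)))).map σA).reverse.prod := by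
  induction k with
  | zero =>
    have h : (List.finRange (n - 1)).filter (fun i : Fin (n - 1) => decide (n - 1 - 0 ≤ (i : ℕ))) = [] := by
      rw [List.filter_eq_nil_iff]
      intro i _
      simp only [decide_eq_true_eq]
      omega
    rw [h]
    simp [sandwich]
  | succ k ih =>
    have e : n - 1 - (k + 1) = n - 1 - 1 - k := by omega
    have e' : n - 1 - k = n - 1 - 1 - k + 1 := by omega
    rw [sandwich, ih (by omega), revσA_of_lt (by omega), e, e',
      List.filter_le_finRange_eq_cons (p := n - 1 - 1 - k) (by omega)]
    simp only [List.map_cons, List.prod_cons, List.reverse_cons, List.prod_append, List.prod_nil,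
      mul_one, mul_assoc]

theorem BL_eq_sandwich {n : ℕ} (i : Fin (n - 1)) :
    BL i = sandwich (revσA n) (ΔA n) (n - 1 - i) := by
  have h : n - 1 - (n - 1 - (i : ℕ)) = i := by omega
  rw [sandwich_revσA_eq (Nat.sub_le _ _), h]
  rfl

theorem exists_BLfull_eq_sandwich {n : ℕ} (a : AffGen n) :
    ∃ k ≤ n - 1, BLfull a = sandwich (revσA n) (ΔA n) k := by
  rcases a with i | u
  · exact ⟨n - 1 - i, Nat.sub_le _ _, BL_eq_sandwich i⟩
  · exact ⟨0, Nat.zero_le _, rfl⟩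

/-- In the affine braid group, the Bernstein–Lusztig elements `Δ_1, …, Δ_{n-1}`
together with `Δ_n` pairwise commute. -/
theorem bernsteinLusztig_commute (n : ℕ) (hn : 2 ≤ n) (a b : AffGen n) :
    BLfull a * BLfull b = BLfull b * BLfull a := by
  obtain ⟨k, hk, hka⟩ := exists_BLfull_eq_sandwich a
  obtain ⟨l, hl, hlb⟩ := exists_BLfull_eq_sandwich b
  rw [hka, hlb]
  refine commute_sandwich_sandwich (m := n - 1) ?_ ?_ ?_ ?_ hk hl
  · intro i hi
    rw [revσA_of_lt (by omega : i < n - 1), revσA_of_lt hi]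
    exact (σA_braid _ _ (by simp only; omega)).symm
  · intro i j hij hj
    rw [revσA_of_lt (by omega : i < n - 1), revσA_of_lt hj]
    exact (σA_commute _ _ (by simp only; omega)).symm
  · intro j hj hjm
    rw [revσA_of_lt hjm]
    exact σA_commute_ΔA _ (by simp only; omega)
  · intro h
    rw [revσA_of_lt h]
    exact σA_mul_ΔA_braid _ (by simp only; omega)
end

section
/- Cocycle identity for the reduced potential (π̄_{12}^*(W̄) + π̄_{23}^*(W̄) = π̄_{13}^*(W̄)): for every n×n upper-triangular complex matrix X, every strictly upper-triangular n×n complex matrix Y, and all invertible n×n complex matrices g and h, one has Tr( X · g · ((h Y h^{-1})_{++}) · g^{-1} ) + Tr( ((g^{-1} X g)_+) · h Y h^{-1} ) = Tr( X · (g h) · Y · (g h)^{-1} ). -/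
open Matrix

/-- The upper-triangular part `M_+` of a square matrix: `(M_+)_{ij} = M_{ij}` if `i ≤ j`
and `0` otherwise. -/
def upperPart {n : ℕ} (M : Matrix (Fin n) (Fin n) ℂ) : Matrix (Fin n) (Fin n) ℂ :=
  Matrix.of fun i j => if i ≤ j then M i j else 0

/-- The strictly upper-triangular part `M_{++}` of a square matrix: `(M_{++})_{ij} = M_{ij}`
if `i < j` and `0` otherwise. -/
def strictUpperPart {n : ℕ} (M : Matrix (Fin n) (Fin n) ℂ) : Matrix (Fin n) (Fin n) ℂ :=
  Matrix.of fun i j => if i < j then M i j else 0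

/-- The trace pairing of `A` and `B` splits into the strictly upper-triangular part of `B` paired
with `A` and the upper-triangular part of `A` paired with `B`. -/
theorem trace_mul_strictUpperPart_add_trace_upperPart_mul {n : ℕ}
    (A B : Matrix (Fin n) (Fin n) ℂ) :
    (A * strictUpperPart B).trace + (upperPart A * B).trace = (A * B).trace := by
  simp only [Matrix.trace, Matrix.diag_apply, Matrix.mul_apply, ← Finset.sum_add_distrib]
  refine Finset.sum_congr rfl fun i _ => Finset.sum_congr rfl fun j _ => ?_
  rcases lt_or_ge j i with hij | hij
  · simp [strictUpperPart, upperPart, hij, hij.not_ge]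
  · simp [strictUpperPart, upperPart, hij, hij.not_gt]

/-- Cocycle identity `π̄_{12}^*(W̄) + π̄_{23}^*(W̄) = π̄_{13}^*(W̄)` for the
reduced potential `W̄(X, g, Y) = Tr(X · Ad_g Y)`: for `X` upper triangular, `Y` strictly upper
triangular and `g, h` invertible,
`Tr(X g (Ad_h Y)_{++} g⁻¹) + Tr((Ad_{g⁻¹} X)_+ · Ad_h Y) = Tr(X (gh) Y (gh)⁻¹)`. -/
theorem potential_cocycle {n : ℕ} (X Y g h : Matrix (Fin n) (Fin n) ℂ)
    (hX : ∀ i j : Fin n, j < i → X i j = 0)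
    (hY : ∀ i j : Fin n, j ≤ i → Y i j = 0)
    (hg : g.det ≠ 0) (hh : h.det ≠ 0) :
    (X * g * strictUpperPart (h * Y * h⁻¹) * g⁻¹).trace +
      (upperPart (g⁻¹ * X * g) * (h * Y * h⁻¹)).trace =
    (X * (g * h) * Y * (g * h)⁻¹).trace := by
  have key := trace_mul_strictUpperPart_add_trace_upperPart_mul (g⁻¹ * X * g) (h * Y * h⁻¹)
  rw [Matrix.trace_mul_comm (X * g * strictUpperPart (h * Y * h⁻¹)) g⁻¹, Matrix.mul_inv_rev,
    ← Matrix.mul_assoc (X * (g * h) * Y) h⁻¹ g⁻¹, Matrix.trace_mul_comm _ g⁻¹]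
  simpa only [Matrix.mul_assoc] using key
end
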